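/- Let s be a non-negative integer and let G be a G_v(s,s+1)-tree with distinguished vertex v. Then at least one of the following holds. (a) The components of G − v can be classified as: exactly one component T1, whose unique vertex v1 adjacent to v satisfies that T1 is a G_{v1}(s−1,s+2)-tree; exactly one component T2, whose unique vertex v2 adjacent to v satisfies that T2 is a G_{v2}(s,s+1)-tree; exactly s − 1 components that are bad trees (so in this case s ≥ 1); and every remaining component T, whose unique vertex u is adjacent to v, is a G_u(−)-tree. (b) The components of G − v can be classified as: exactly s components that are bad trees, and every remaining component T, whose unique vertex u is adjacent to v, is a G_u(−)-tree. -/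

import Mathlib

open scoped Classical

/-- The weighted degree of vertex `v` under edge-weighting `w`:
the sum of the weights of the edges incident with `v`. -/
noncomputable def wdeg {V : Type} [Fintype V] (G : SimpleGraph V) (w : Sym2 V → ℕ) (v : V) : ℕ :=
  ∑ u ∈ Finset.univ.filter (fun u => G.Adj v u), w s(v, u)

/-- `w` is a `{0,1}`-weighting of `G`: every edge gets weight `0` or `1`. -/
def Is01Weighting {V : Type} (G : SimpleGraph V) (w : Sym2 V → ℕ) : Prop :=
  ∀ e ∈ G.edgeSet, w e = 0 ∨ w e = 1

/-- `G` has the `{0,1}`-property: it admits a proper (neighbour sum-distinguishing)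
`{0,1}`-edge-weighting. A graph without this property is called *bad*. -/
def HasZeroOneProperty {V : Type} [Fintype V] (G : SimpleGraph V) : Prop :=
  ∃ w : Sym2 V → ℕ, Is01Weighting G w ∧
    ∀ ⦃u v : V⦄, G.Adj u v → wdeg G w u ≠ wdeg G w v
/-- The colour of `x`: its weighted degree, increased by `1` if `x = v`
(i.e. the weighted degree of `v` is increased by `1`). -/
noncomputable def wdegPlus {V : Type} [Fintype V] (G : SimpleGraph V) (w : Sym2 V → ℕ)
    (v x : V) : ℕ :=
  wdeg G w x + if x = v then 1 else 0

/-- `G` is a `G_v(−)`-graph: there is no `{0,1}`-weighting of `G` which is proper when the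
weighted degree of `v` is increased by `1`. -/
def GvMinus {V : Type} [Fintype V] (G : SimpleGraph V) (v : V) : Prop :=
  ¬ ∃ w : Sym2 V → ℕ, Is01Weighting G w ∧
      ∀ ⦃x y : V⦄, G.Adj x y → wdegPlus G w v x ≠ wdegPlus G w v y

/-- `G` is a `G_v(a,b)`-graph: in every proper `{0,1}`-weighting of `G` the vertex `v` has
weighted degree `a`, and in every `{0,1}`-weighting of `G` which is proper when the weighted
degree of `v` is increased by `1`, the increased weighted degree of `v` is `b`. -/
def GvAB {V : Type} [Fintype V] (G : SimpleGraph V) (v : V) (a b : ℕ) : Prop :=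
  (∀ w : Sym2 V → ℕ, Is01Weighting G w →
      (∀ ⦃x y : V⦄, G.Adj x y → wdeg G w x ≠ wdeg G w y) → wdeg G w v = a) ∧
  (∀ w : Sym2 V → ℕ, Is01Weighting G w →
      (∀ ⦃x y : V⦄, G.Adj x y → wdegPlus G w v x ≠ wdegPlus G w v y) →
        wdeg G w v + 1 = b)
/-- The vertex set of the component of `G - v` containing `u`: all vertices reachable
from `u` after deleting every edge incident with `v`. -/
def compSet {V : Type} (G : SimpleGraph V) (v u : V) : Set V :=
  {x | (G.deleteEdges {e : Sym2 V | v ∈ e}).Reachable u x}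

/-- The vertex `u`, as a vertex of the component of `G - v` containing it. -/
def compVert {V : Type} (G : SimpleGraph V) (v u : V) : ↥(compSet G v u) :=
  ⟨u, SimpleGraph.Reachable.refl u⟩

theorem root_count_cases (r b s : ℕ) (α π : ℕ → ℕ)
    (hα : ∀ n, ∑ c ∈ Finset.range n, α c ≤ r) (hπ : ∀ n, ∑ c ∈ Finset.range n, π c ≤ r)
    (hinf : ∀ i ≤ r, b + i ≠ s → ∀ ε ≤ 1, i < α (i + ε) ∨ r < i + π (i + ε)) :
    (r = 0 ∧ s = b) ∨ (r = 2 ∧ s = b + 1 ∧ 0 < α 0 ∧ 0 < α 1 ∧ 0 < π 2 ∧ 0 < π 3) := by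
  have hle : ∀ f : ℕ → ℕ, (∀ n, ∑ c ∈ Finset.range n, f c ≤ r) → ∀ c, f c ≤ r := fun f hf c =>
    (Finset.single_le_sum (fun _ _ => Nat.zero_le _) (Finset.self_mem_range_succ c)).trans
      (hf (c + 1))
  have hr : r ≤ 2 := by
    by_contra! hr
    have key : ∀ c ∈ Finset.range (r + 2), 2 + (if c = 2 then 1 else 0) ≤
        α c + π c + (if b + c = s then 1 else 0) + (if b + c = s + 1 then 1 else 0) +
          (if c = 0 then 1 else 0) + (if c = r + 1 then 1 else 0) := by
      intro c hc
      rw [Finset.mem_range] at hc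
      have h₀ : c ≤ r → b + c ≠ s → c < α c ∨ r < c + π c :=
        fun h h' => hinf c h h' 0 (by omega)
      have h₁ : c ≠ 0 → b + c ≠ s + 1 → c - 1 < α c ∨ r < c - 1 + π c := by
        intro h h'
        have := hinf (c - 1) (by omega) (by omega) 1 le_rfl
        rwa [show c - 1 + 1 = c by omega] at this
      have := hle α hα c
      have := hle π hπ c
      split_ifs <;> omega
    have hsum := Finset.sum_le_sum key
    have hone : ∀ t, ∑ c ∈ Finset.range (r + 2), (if b + c = t then 1 else 0) ≤ 1 := by
      intro t
      rw [← Finset.card_filter, Finset.card_le_one]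
      intro x hx y hy
      simp only [Finset.mem_filter] at hx hy
      omega
    have h₁ := hα (r + 2)
    have h₂ := hπ (r + 2)
    have h₃ := hone s
    have h₄ := hone (s + 1)
    simp only [Finset.sum_add_distrib, Finset.sum_const, Finset.card_range, Finset.sum_ite_eq',
      Finset.mem_range, smul_eq_mul] at hsum
    rw [if_pos (by omega), if_pos (by omega), if_pos (by omega)] at hsum
    omega
  have h₁ := hα 4
  have h₂ := hπ 4
  simp only [Finset.sum_range_succ, Finset.sum_range_zero] at h₁ h₂
  have e₀₀ := fun h => hinf 0 (Nat.zero_le _) h 0 (by omega)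
  have e₀₁ := fun h => hinf 0 (Nat.zero_le _) h 1 (by omega)
  have e₁₀ := fun h h' => hinf 1 h h' 0 (by omega)
  have e₁₁ := fun h h' => hinf 1 h h' 1 (by omega)
  have e₂₀ := fun h h' => hinf 2 h h' 0 (by omega)
  have e₂₁ := fun h h' => hinf 2 h h' 1 (by omega)
  simp only [Nat.reduceAdd, add_zero] at e₀₀ e₀₁ e₁₀ e₁₁ e₂₀ e₂₁
  interval_cases r <;> omega

/-- Combinatorial core: `A u` and `P u` are the possible colours of the root `u` of a branch
when the edge joining the branch to the centre has weight `0` respectively `1`. -/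
theorem classify_branches {ι : Type} (N : Finset ι) (A P : ι → Set ℕ) (s : ℕ)
    (hpar : ∀ u ∈ N, ∀ j : ℕ, ∃ k, k % 2 = j % 2 ∧ (k ∈ A u ∨ k ∈ P u))
    (hglue : ∀ S ⊆ N, ∀ ε ≤ 1,
      (∀ u ∈ N, ∃ k ∈ (if u ∈ S then P u else A u), k ≠ S.card + ε) → S.card = s) :
    (1 ≤ s ∧ ∃ v₁ ∈ N, ∃ v₂ ∈ N, v₁ ≠ v₂ ∧ A v₁ ⊆ {s - 1} ∧ P v₁ ⊆ {s + 2} ∧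
        A v₂ ⊆ {s} ∧ P v₂ ⊆ {s + 1} ∧
        ∃ B ⊆ N, v₁ ∉ B ∧ v₂ ∉ B ∧ B.card = s - 1 ∧ (∀ b ∈ B, A b = ∅) ∧
          ∀ u ∈ N, u ≠ v₁ → u ≠ v₂ → u ∉ B → P u = ∅) ∨
    ∃ B ⊆ N, B.card = s ∧ (∀ b ∈ B, A b = ∅) ∧ ∀ u ∈ N, u ∉ B → P u = ∅ := by
  have hexcl : ∀ u ∈ N, ∀ c, A u ⊆ {c} → ¬ P u ⊆ {c} := by
    intro u hu c hA hP
    obtain ⟨k, hk, h⟩ := hpar u hu (c + 1)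
    have : k = c := h.elim (fun h => hA h) (fun h => hP h)
    omega
  -- Infeasibility of every number `d ≠ s` of edges of weight `1` at the centre.
  have hinf : ∀ d, d ≠ s → ∀ ε ≤ 1, d ≤ N.card →
      d < (N.filter fun u => A u ⊆ {d + ε}).card ∨
        N.card < d + (N.filter fun u => P u ⊆ {d + ε}).card := by
    intro d hd ε hε hdN
    by_contra! hcon
    obtain ⟨h₁, h₂⟩ := hcon
    have hsub : (N.filter fun u => A u ⊆ {d + ε}) ⊆ N \ N.filter fun u => P u ⊆ {d + ε} := by
      intro u hu
      simp only [Finset.mem_filter, Finset.mem_sdiff, not_and] at hu ⊢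
      exact ⟨hu.1, fun _ => hexcl u hu.1 _ hu.2⟩
    obtain ⟨S, hS₁, hS₂, rfl⟩ := Finset.exists_subsuperset_card_eq hsub h₁ (by
      rw [Finset.card_sdiff_of_subset (Finset.filter_subset _ _)]; omega)
    refine hd (hglue S (hS₂.trans Finset.sdiff_subset) ε hε fun u hu => ?_)
    split_ifs with huS
    · have := hS₂ huS
      simp only [Finset.mem_filter, Finset.mem_sdiff, not_and] at this
      obtain ⟨k, hk, hk'⟩ := Set.not_subset.1 (this.2 hu)
      exact ⟨k, hk, hk'⟩
    · obtain ⟨k, hk, hk'⟩ := Set.not_subset.1 fun h => huS (hS₁ (Finset.mem_filter.2 ⟨hu, h⟩))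
      exact ⟨k, hk, hk'⟩
  set B := N.filter fun u => A u = ∅ with hB
  set M := N.filter fun u => P u = ∅ with hM
  set R := N.filter fun u => A u ≠ ∅ ∧ P u ≠ ∅ with hR
  have hcard : N.card = B.card + M.card + R.card := by
    rw [← Finset.card_union_of_disjoint, ← Finset.card_union_of_disjoint]
    · congr 1
      ext u
      simp only [hB, hM, hR, Finset.mem_union, Finset.mem_filter]
      tauto
    · rw [Finset.disjoint_left]
      intro u
      simp only [hB, hM, hR, Finset.mem_union, Finset.mem_filter]
      tauto
    · rw [Finset.disjoint_left]
      intro u hu hu'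
      simp only [hB, hM, Finset.mem_filter] at hu hu'
      exact hexcl u hu.1 0 (by simp [hu.2]) (by simp [hu'.2])
  let α : ℕ → ℕ := fun c => (R.filter fun u => A u ⊆ {c}).card
  let π : ℕ → ℕ := fun c => (R.filter fun u => P u ⊆ {c}).card
  have hF₁ : ∀ c, (N.filter fun u => A u ⊆ {c}).card ≤ B.card + α c := by
    intro c
    refine le_trans (Finset.card_le_card fun u hu => ?_) (Finset.card_union_le _ _)
    have := hexcl u (Finset.mem_filter.1 hu).1 c (Finset.mem_filter.1 hu).2
    simp only [hB, hR, Finset.mem_union, Finset.mem_filter] at hu ⊢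
    have : P u ≠ ∅ := by rintro h; simp [h] at this
    tauto
  have hF₀ : ∀ c, (N.filter fun u => P u ⊆ {c}).card ≤ M.card + π c := by
    intro c
    refine le_trans (Finset.card_le_card fun u hu => ?_) (Finset.card_union_le _ _)
    have := mt (hexcl u (Finset.mem_filter.1 hu).1 c) (not_not.2 (Finset.mem_filter.1 hu).2)
    simp only [hM, hR, Finset.mem_union, Finset.mem_filter] at hu ⊢
    have : A u ≠ ∅ := by rintro h; simp [h] at this
    tauto
  have hinf' : ∀ i ≤ R.card, B.card + i ≠ s → ∀ ε ≤ 1,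
      i < α (B.card + (i + ε)) ∨ R.card < i + π (B.card + (i + ε)) := by
    intro i hi his ε hε
    rw [← add_assoc]
    have := hinf _ his ε hε (by omega)
    have h₁ := hF₁ (B.card + i + ε)
    have h₀ := hF₀ (B.card + i + ε)
    omega
  have hsum : ∀ X : ι → Set ℕ, (∀ u ∈ R, X u ≠ ∅) →
      ∀ n, ∑ c ∈ Finset.range n, (R.filter fun u => X u ⊆ {B.card + c}).card ≤ R.card := by
    intro X hX n
    rw [← Finset.card_biUnion]
    · exact Finset.card_le_card (Finset.biUnion_subset.2 fun _ _ => Finset.filter_subset _ _)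
    · intro c _ c' _ hcc'
      rw [Function.onFun, Finset.disjoint_left]
      intro u hu hu'
      simp only [Finset.mem_filter] at hu hu'
      obtain ⟨k, hk⟩ := Set.nonempty_iff_ne_empty.2 (hX u hu.1)
      have h₁ : k = _ := hu.2 hk
      have h₂ : k = _ := hu'.2 hk
      omega
  have hRA : ∀ u ∈ R, A u ≠ ∅ := fun u hu => (Finset.mem_filter.1 hu).2.1
  have hRP : ∀ u ∈ R, P u ≠ ∅ := fun u hu => (Finset.mem_filter.1 hu).2.2
  have hα : ∀ n, ∑ c ∈ Finset.range n, α (B.card + c) ≤ R.card := hsum A hRA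
  have hπ : ∀ n, ∑ c ∈ Finset.range n, π (B.card + c) ≤ R.card := hsum P hRP
  rcases root_count_cases R.card B.card s (fun c => α (B.card + c)) (fun c => π (B.card + c)) hα hπ
    hinf' with ⟨hr0, hsB⟩ | ⟨hr2, hs, hα₀, hα₁, hπ₂, hπ₃⟩
  · right
    refine ⟨B, Finset.filter_subset _ _, hsB.symm, fun b hb => (Finset.mem_filter.1 hb).2,
      fun u hu huB => ?_⟩
    by_contra hP
    have : u ∈ R := Finset.mem_filter.2 ⟨hu, fun h => huB (Finset.mem_filter.2 ⟨hu, h⟩), hP⟩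
    rw [Finset.card_eq_zero] at hr0
    simp [hr0] at this
  · left
    have pick : ∀ X : ι → Set ℕ, ∀ c, 0 < (R.filter fun u => X u ⊆ {c}).card →
        ∃ u ∈ R, X u ⊆ {c} := by
      intro X c h
      obtain ⟨u, hu⟩ := Finset.card_pos.1 h
      exact ⟨u, (Finset.mem_filter.1 hu).1, (Finset.mem_filter.1 hu).2⟩
    obtain ⟨v₁, hv₁, hA₁⟩ := pick A B.card hα₀
    obtain ⟨v₂, hv₂, hA₂⟩ := pick A (B.card + 1) hα₁
    obtain ⟨u₂, hu₂, hP₂⟩ := pick P (B.card + 2) hπ₂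
    obtain ⟨u₁, hu₁, hP₁⟩ := pick P (B.card + 3) hπ₃
    have hRN : R ⊆ N := Finset.filter_subset _ _
    have hne : ∀ X : ι → Set ℕ, ∀ c c', (∀ u ∈ R, X u ≠ ∅) → ∀ u ∈ R, X u ⊆ {c} →
        ∀ u' ∈ R, X u' ⊆ {c'} → c ≠ c' → u ≠ u' := by
      rintro X c c' hX u hu h u' - h' hcc rfl
      obtain ⟨k, hk⟩ := Set.nonempty_iff_ne_empty.2 (hX u hu)
      exact hcc ((h hk : k = c).symm.trans (h' hk))
    have hv : v₁ ≠ v₂ := hne A _ _ hRA v₁ hv₁ hA₁ v₂ hv₂ hA₂ (by omega)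
    have hu : u₁ ≠ u₂ := hne P _ _ hRP u₁ hu₁ hP₁ u₂ hu₂ hP₂ (by omega)
    have hR' : R = {v₁, v₂} := by
      symm
      apply Finset.eq_of_subset_of_card_le
      · simp [Finset.insert_subset_iff, hv₁, hv₂]
      · rw [Finset.card_pair hv, hr2]
    have huv : u₂ ≠ v₁ := by
      rintro rfl
      obtain ⟨k, hk, h⟩ := hpar u₂ (hRN hu₂) (B.card + 1)
      rcases h with h | h
      · have : k = _ := hA₁ h
        omega
      · have : k = _ := hP₂ h
        omega
    have hu₂' : u₂ = v₂ := by
      have := hu₂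
      rw [hR'] at this
      simp only [Finset.mem_insert, Finset.mem_singleton] at this
      tauto
    have hu₁' : u₁ = v₁ := by
      have := hu₁
      rw [hR'] at this
      simp only [Finset.mem_insert, Finset.mem_singleton] at this
      subst hu₂'
      tauto
    subst hu₁' hu₂' hs
    refine ⟨by omega, u₁, hRN hv₁, u₂, hRN hv₂, hv, hA₁, hP₁, hA₂, hP₂, B,
      Finset.filter_subset _ _, fun h => hRA _ hv₁ (Finset.mem_filter.1 h).2,
      fun h => hRA _ hv₂ (Finset.mem_filter.1 h).2, rfl,
      fun b hb => (Finset.mem_filter.1 hb).2, fun u hu h₁ h₂ huB => ?_⟩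
    by_contra hP
    have : u ∈ R := Finset.mem_filter.2 ⟨hu, fun h => huB (Finset.mem_filter.2 ⟨hu, h⟩), hP⟩
    rw [hR'] at this
    simp [h₁, h₂] at this

/-- The possible values of the colour of `u` in a `{0,1}`-weighting of `H` that is proper once
`δ` is added to the weighted degree of `u`. -/
def rootColours {V : Type} [Fintype V] (H : SimpleGraph V) (u : V) (δ : ℕ) : Set ℕ :=
  {c | ∃ w : Sym2 V → ℕ, Is01Weighting H w ∧
    (∀ ⦃x y : V⦄, H.Adj x y →
      wdeg H w x + (if x = u then δ else 0) ≠ wdeg H w y + (if y = u then δ else 0)) ∧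
    wdeg H w u + δ = c}

theorem SimpleGraph.Walk.sum_count_edges {V : Type} [Fintype V] {H : SimpleGraph V} {a b : V}
    (p : H.Walk a b) (y : V) :
    ∑ z ∈ Finset.univ.filter (fun z => H.Adj y z), (p.edges.count s(y, z) : ZMod 2) =
      (if y = a then 1 else 0) + (if y = b then 1 else 0) := by
  induction p with
  | nil => split_ifs <;> simp; decide
  | @cons a a' b hab p ih =>
    have hstep : ∑ z ∈ Finset.univ.filter (fun z => H.Adj y z),
        (if s(a, a') = s(y, z) then 1 else 0 : ZMod 2) =
        (if y = a then 1 else 0) + (if y = a' then 1 else 0) := by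
      by_cases h₁ : y = a
      · subst h₁
        simp only [Sym2.congr_right, Finset.sum_ite_eq]
        simp [hab, hab.ne]
      · by_cases h₂ : y = a'
        · subst h₂
          simp [hab.ne, hab.ne', hab.symm]
        · simp [h₁, h₂, Ne.symm h₁, Ne.symm h₂]
    simp only [SimpleGraph.Walk.edges_cons, List.count_cons, Nat.cast_add, Nat.cast_ite,
      Nat.cast_one, Nat.cast_zero, Finset.sum_add_distrib, ih, beq_iff_eq, hstep]
    have : ∀ i j k : ZMod 2, j + k + (i + j) = i + k := by decide
    exact this _ _ _

theorem exists_weighting_mod_two {V : Type} [Fintype V] {H : SimpleGraph V} (hH : H.Connected)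
    (u : V) (t : V → ZMod 2) :
    ∃ w : Sym2 V → ℕ, Is01Weighting H w ∧ ∀ x, x ≠ u → (wdeg H w x : ZMod 2) = t x := by
  have p : ∀ x, H.Walk x u := fun x => (hH x u).some
  refine ⟨fun e => (∑ x ∈ Finset.univ.erase u, t x * ((p x).edges.count e : ZMod 2)).val,
    fun e _ => ?_, fun x hx => ?_⟩
  · have := ZMod.val_lt (∑ x ∈ Finset.univ.erase u, t x * ((p x).edges.count e : ZMod 2))
    dsimp only
    omega
  · simp only [wdeg, Nat.cast_sum, ZMod.natCast_val, ZMod.cast_id', id]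
    rw [Finset.sum_comm]
    simp only [← Finset.mul_sum, SimpleGraph.Walk.sum_count_edges, if_neg hx, add_zero]
    simp [hx]

theorem exists_mem_rootColours_mod_two {V : Type} [Fintype V] {H : SimpleGraph V}
    (hH : H.Connected) (χ : H.Coloring (ZMod 2)) (u : V) (j : ℕ) :
    ∃ k, k % 2 = j % 2 ∧ (k ∈ rootColours H u 0 ∨ k ∈ rootColours H u 1) := by
  obtain ⟨w, hw, hdeg⟩ := exists_weighting_mod_two hH u fun x => χ x - χ u + j
  have key : ∀ δ : ℕ, ((wdeg H w u + δ : ℕ) : ZMod 2) = j → wdeg H w u + δ ∈ rootColours H u δ := by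
    refine fun δ hδ => ⟨w, hw, fun x y hxy heq => χ.valid hxy ?_, rfl⟩
    have hcol : ∀ z, ((wdeg H w z + (if z = u then δ else 0) : ℕ) : ZMod 2) = χ z - χ u + j := by
      intro z
      split_ifs with hz
      · rw [hz, hδ, sub_self, zero_add]
      · rw [add_zero, hdeg z hz]
    have := (hcol x).symm.trans ((congrArg _ heq).trans (hcol y))
    simpa using this
  by_cases h : wdeg H w u % 2 = j % 2
  · exact ⟨_, h, .inl (key 0 ((ZMod.natCast_eq_natCast_iff' _ _ 2).2 h))⟩
  · have h' : (wdeg H w u + 1) % 2 = j % 2 := by omega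
    exact ⟨_, h', .inr (key 1 ((ZMod.natCast_eq_natCast_iff' _ _ 2).2 h'))⟩

section Branches

variable {V : Type} {G : SimpleGraph V} {v u x y : V}

theorem deleteEdges_incident_adj :
    (G.deleteEdges {e : Sym2 V | v ∈ e}).Adj x y ↔ G.Adj x y ∧ v ≠ x ∧ v ≠ y := by
  simp [SimpleGraph.deleteEdges_adj, not_or]

theorem ne_of_mem_compSet (hu : G.Adj v u) (hx : x ∈ compSet G v u) : x ≠ v := by
  rintro rfl
  obtain ⟨p⟩ := SimpleGraph.Reachable.symm hx
  cases p with
  | nil => exact hu.ne rfl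
  | cons h _ => exact (deleteEdges_incident_adj.1 h).2.1 rfl

theorem mem_compSet_of_adj (hx : x ∈ compSet G v u) (hxy : G.Adj x y) (hxv : x ≠ v)
    (hyv : y ≠ v) : y ∈ compSet G v u :=
  SimpleGraph.Reachable.trans hx
    (deleteEdges_incident_adj.2 ⟨hxy, hxv.symm, hyv.symm⟩).reachable

theorem exists_mem_compSet (hG : G.Connected) (hx : x ≠ v) :
    ∃ u, G.Adj v u ∧ x ∈ compSet G v u := by
  obtain ⟨p⟩ := hG x v
  induction p with
  | nil => exact absurd rfl hx
  | @cons a b c h p ih =>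
    by_cases hb : b = c
    · subst hb
      exact ⟨a, h.symm, SimpleGraph.Reachable.refl _⟩
    · obtain ⟨u, hu, hbu⟩ := ih hb
      exact ⟨u, hu, mem_compSet_of_adj hbu h.symm hb hx⟩

theorem eq_of_adj_of_mem_compSet (hG : G.IsAcyclic) (hu : G.Adj v u) (hx : x ∈ compSet G v u)
    (hvx : G.Adj v x) : x = u := by
  by_contra hxu
  have hb := SimpleGraph.isAcyclic_iff_forall_adj_isBridge.1 hG hu
  rw [SimpleGraph.isBridge_iff] at hb
  refine hb (SimpleGraph.Reachable.trans (SimpleGraph.Adj.reachable (v := x) ?_)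
    (SimpleGraph.Reachable.mono ?_ (SimpleGraph.Reachable.symm hx)))
  · simp [SimpleGraph.deleteEdges_adj, hvx, hxu, hu.ne]
  · intro a b hab
    obtain ⟨h, ha, hb⟩ := deleteEdges_incident_adj.1 hab
    simp [SimpleGraph.deleteEdges_adj, h, ha.symm, hb.symm]

theorem compSet_root_unique (hG : G.IsAcyclic) {u' : V} (hu : G.Adj v u) (hu' : G.Adj v u')
    (hx : x ∈ compSet G v u) (hx' : x ∈ compSet G v u') : u' = u :=
  eq_of_adj_of_mem_compSet hG hu (SimpleGraph.Reachable.trans hx (SimpleGraph.Reachable.symm hx'))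
    hu'

theorem induce_compSet_connected (hu : G.Adj v u) : (G.induce (compSet G v u)).Connected := by
  have hroot : ∀ x (hx : x ∈ compSet G v u),
      (G.induce (compSet G v u)).Reachable ⟨x, hx⟩ (compVert G v u) := by
    intro x hx
    obtain ⟨p⟩ := SimpleGraph.Reachable.symm hx
    induction p with
    | nil => exact SimpleGraph.Reachable.refl _
    | @cons a b c h p ih =>
      have hb : b ∈ compSet G v c := SimpleGraph.Reachable.symm ⟨p⟩
      refine SimpleGraph.Reachable.trans (SimpleGraph.Adj.reachable (v := ⟨b, hb⟩) ?_) (ih hu hb)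
      exact (deleteEdges_incident_adj.1 h).1
  exact { preconnected := fun a b => (hroot a.1 a.2).trans (hroot b.1 b.2).symm
          nonempty := ⟨compVert G v u⟩ }

end Branches

theorem card_add_mem_rootColours {V : Type} [Fintype V] {G : SimpleGraph V} (hG : G.IsTree)
    (v : V) (S : Finset V) (hS : ∀ u ∈ S, G.Adj v u) (ε : ℕ)
    (h : ∀ u, G.Adj v u → ∃ k ∈ rootColours (G.induce (compSet G v u)) (compVert G v u)
      (if u ∈ S then 1 else 0), k ≠ S.card + ε) :
    S.card + ε ∈ rootColours G v ε := by
  have hbranch : ∀ u, ∃ w : Sym2 (compSet G v u) → ℕ, G.Adj v u →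
      Is01Weighting (G.induce (compSet G v u)) w ∧
      (∀ ⦃x y⦄, (G.induce (compSet G v u)).Adj x y →
        wdeg (G.induce (compSet G v u)) w x +
            (if x = compVert G v u then if u ∈ S then 1 else 0 else 0) ≠
          wdeg (G.induce (compSet G v u)) w y +
            (if y = compVert G v u then if u ∈ S then 1 else 0 else 0)) ∧
      wdeg (G.induce (compSet G v u)) w (compVert G v u) + (if u ∈ S then 1 else 0) ≠
        S.card + ε := by
    intro u
    by_cases hu : G.Adj v u
    · obtain ⟨k, ⟨w, hw, hproper, rfl⟩, hk⟩ := h u hu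
      exact ⟨w, fun _ => ⟨hw, fun x y hxy => by convert hproper hxy, hk⟩⟩
    · exact ⟨0, fun h => absurd h hu⟩
  choose wt hwt using hbranch
  set W : Sym2 V → ℕ := fun e => (if ∃ u ∈ S, e = s(v, u) then 1 else 0) +
    ∑ u ∈ Finset.univ.filter (fun u => G.Adj v u),
      Function.extend (Sym2.map Subtype.val) (wt u) 0 e with hW
  have hWv : ∀ u, W s(v, u) = if u ∈ S then 1 else 0 := by
    intro u
    have : ∑ u' ∈ Finset.univ.filter (fun u' => G.Adj v u'),
        Function.extend (Sym2.map Subtype.val) (wt u') 0 s(v, u) = 0 := by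
      refine Finset.sum_eq_zero fun u' hu' => Function.extend_apply' _ _ _ ?_
      rintro ⟨e, he⟩
      obtain ⟨x, -, hx⟩ := Sym2.mem_map.1 (he ▸ Sym2.mem_mk_left v u : v ∈ Sym2.map _ e)
      exact ne_of_mem_compSet (Finset.mem_filter.1 hu').2 x.2 hx
    simp only [hW, this, add_zero, Sym2.congr_right]
    simp
  have hWin : ∀ u, G.Adj v u → ∀ x y : compSet G v u, W s(x.1, y.1) = wt u s(x, y) := by
    intro u hu x y
    have h₀ : ¬ ∃ u' ∈ S, s(x.1, y.1) = s(v, u') := by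
      rintro ⟨u', -, he⟩
      rcases Sym2.mem_iff.1 (he ▸ Sym2.mem_mk_left v u' : v ∈ s(x.1, y.1)) with h | h
      · exact ne_of_mem_compSet hu x.2 h.symm
      · exact ne_of_mem_compSet hu y.2 h.symm
    simp only [hW, if_neg h₀, zero_add]
    rw [Finset.sum_eq_single_of_mem u (Finset.mem_filter.2 ⟨Finset.mem_univ _, hu⟩)]
    · exact (Sym2.map.injective Subtype.val_injective).extend_apply (wt u) 0 s(x, y)
    · intro u' hu' hne
      refine Function.extend_apply' _ _ _ ?_
      rintro ⟨e, he⟩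
      obtain ⟨z, -, hz⟩ := Sym2.mem_map.1
        (he ▸ Sym2.mem_mk_left x.1 y.1 : x.1 ∈ Sym2.map _ e)
      exact hne (compSet_root_unique hG.isAcyclic hu (Finset.mem_filter.1 hu').2 x.2 (hz ▸ z.2))
  have hdegv : wdeg G W v = S.card := by
    simp only [wdeg, hWv]
    rw [← Finset.card_filter]
    congr 1
    ext u
    simpa using hS u
  have hdegin : ∀ u, G.Adj v u → ∀ x : compSet G v u, wdeg G W x =
      wdeg (G.induce (compSet G v u)) (wt u) x +
        (if x = compVert G v u then if u ∈ S then 1 else 0 else 0) := by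
    intro u hu x
    have hxv := ne_of_mem_compSet hu x.2
    have hin : wdeg (G.induce (compSet G v u)) (wt u) x =
        ∑ y ∈ Finset.univ.filter (fun y => G.Adj x y ∧ y ≠ v), W s(x.1, y) := by
      refine Finset.sum_bij (fun y _ => y.1) ?_ ?_ ?_ ?_
      · intro y hy
        have : G.Adj x y := (Finset.mem_filter.1 hy).2
        simp [this, ne_of_mem_compSet hu y.2]
      · exact fun _ _ _ _ h => Subtype.ext h
      · intro y hy
        obtain ⟨hxy, hyv⟩ := (Finset.mem_filter.1 hy).2
        exact ⟨⟨y, mem_compSet_of_adj x.2 hxy hxv hyv⟩, by simpa using hxy, rfl⟩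
      · exact fun y _ => (hWin u hu x y).symm
    have hout : (if x = compVert G v u then if u ∈ S then 1 else 0 else 0) =
        ∑ y ∈ Finset.univ.filter (fun y => G.Adj x y ∧ ¬ y ≠ v), W s(x.1, y) := by
      have hx : x = compVert G v u ↔ G.Adj x v :=
        ⟨fun h => h ▸ hu.symm,
          fun h => Subtype.ext (eq_of_adj_of_mem_compSet hG.isAcyclic hu x.2 h.symm)⟩
      by_cases hxu : x = compVert G v u
      · have hf : Finset.univ.filter (fun y => G.Adj x y ∧ ¬ y ≠ v) = {v} := by
          ext y
          simp only [Finset.mem_filter, Finset.mem_univ, true_and, Finset.mem_singleton, not_not]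
          exact ⟨fun h => h.2, fun h => ⟨h ▸ hx.1 hxu, h⟩⟩
        rw [if_pos hxu, hf, Finset.sum_singleton, Sym2.eq_swap, hWv, hxu]
        rfl
      · rw [if_neg hxu]
        symm
        refine Finset.sum_eq_zero fun y hy => ?_
        obtain ⟨hxy, hyv⟩ := (Finset.mem_filter.1 hy).2
        exact absurd (hx.2 (not_not.1 hyv ▸ hxy)) hxu
    rw [hin, hout, ← Finset.filter_filter, ← Finset.filter_filter,
      Finset.sum_filter_add_sum_filter_not]
    rfl
  have hroot : ∀ y, G.Adj v y → wdeg G W v + ε ≠ wdeg G W y := by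
    intro y hy
    rw [hdegv, show y = (compVert G v y).1 from rfl, hdegin y hy, if_pos rfl]
    exact ((hwt y hy).2.2).symm
  refine ⟨W, ?_, ?_, by rw [hdegv]⟩
  · rintro ⟨x, y⟩ (hxy : G.Adj x y)
    change W s(x, y) = 0 ∨ W s(x, y) = 1
    by_cases hxv : x = v
    · subst hxv
      rw [hWv]
      split_ifs <;> simp
    by_cases hyv : y = v
    · subst hyv
      rw [Sym2.eq_swap, hWv]
      split_ifs <;> simp
    obtain ⟨u, hu, hx⟩ := exists_mem_compSet hG.connected hxv
    have hy := mem_compSet_of_adj hx hxy hxv hyv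
    rw [hWin u hu ⟨x, hx⟩ ⟨y, hy⟩]
    exact (hwt u hu).1 s(⟨x, hx⟩, ⟨y, hy⟩) hxy
  · intro x y hxy
    by_cases hxv : x = v
    · subst hxv
      rw [if_pos rfl, if_neg hxy.ne', add_zero]
      exact hroot y hxy
    by_cases hyv : y = v
    · subst hyv
      rw [if_pos rfl, if_neg hxy.ne, add_zero]
      exact (hroot x hxy.symm).symm
    obtain ⟨u, hu, hx⟩ := exists_mem_compSet hG.connected hxv
    have hy := mem_compSet_of_adj hx hxy hxv hyv
    rw [if_neg hxv, if_neg hyv, add_zero, add_zero, hdegin u hu ⟨x, hx⟩, hdegin u hu ⟨y, hy⟩]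
    exact (hwt u hu).2.1 (x := ⟨x, hx⟩) (y := ⟨y, hy⟩) hxy

section Properties

variable {V : Type} [Fintype V] {G : SimpleGraph V} {v : V}

theorem gvAB_iff_rootColours_subset {a b : ℕ} :
    GvAB G v a b ↔ rootColours G v 0 ⊆ {a} ∧ rootColours G v 1 ⊆ {b} := by
  refine and_congr ⟨?_, ?_⟩ ⟨?_, ?_⟩
  · rintro h _ ⟨w, hw, hp, rfl⟩
    exact h w hw (by simpa using hp)
  · exact fun h w hw hp => h ⟨w, hw, by simpa using hp, rfl⟩
  · rintro h _ ⟨w, hw, hp, rfl⟩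
    exact h w hw hp
  · exact fun h w hw hp => h ⟨w, hw, hp, rfl⟩

theorem gvMinus_of_rootColours_eq_empty (h : rootColours G v 1 = ∅) : GvMinus G v := by
  rintro ⟨w, hw, hp⟩
  exact h.subset (show wdeg G w v + 1 ∈ rootColours G v 1 from ⟨w, hw, hp, rfl⟩)

theorem not_hasZeroOneProperty_of_rootColours_eq_empty (h : rootColours G v 0 = ∅) :
    ¬ HasZeroOneProperty G := by
  rintro ⟨w, hw, hp⟩
  exact h.subset (show wdeg G w v + 0 ∈ rootColours G v 0 from ⟨w, hw, by simpa using hp, rfl⟩)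

end Properties

/-- Let `s ≥ 0` and let the tree `G` (finite, with an odd number of
vertices) be a `G_v(s,s+1)`-tree. Then either
(a) `s ≥ 1` and the components of `G - v` consist of one `G_{v₁}(s-1,s+2)`-tree, one
`G_{v₂}(s,s+1)`-tree, exactly `s - 1` bad trees, and `G_u(−)`-trees for all remaining
neighbours `u` of `v`; or
(b) the components of `G - v` consist of exactly `s` bad trees and `G_u(−)`-trees for all
remaining neighbours `u` of `v`. -/
theorem statement14 {V : Type} [Fintype V] (G : SimpleGraph V) (hG : G.IsTree)
    (hodd : Odd (Fintype.card V)) (v : V) (s : ℕ) (h : GvAB G v s (s + 1)) :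
    (1 ≤ s ∧ ∃ v₁ v₂ : V, G.Adj v v₁ ∧ G.Adj v v₂ ∧ v₁ ≠ v₂ ∧
        GvAB (G.induce (compSet G v v₁)) (compVert G v v₁) (s - 1) (s + 2) ∧
        GvAB (G.induce (compSet G v v₂)) (compVert G v v₂) s (s + 1) ∧
        ∃ B : Finset V, (∀ b ∈ B, G.Adj v b) ∧ v₁ ∉ B ∧ v₂ ∉ B ∧ B.card = s - 1 ∧
          (∀ b ∈ B, ¬ HasZeroOneProperty (G.induce (compSet G v b))) ∧
          ∀ u : V, G.Adj v u → u ≠ v₁ → u ≠ v₂ → u ∉ B →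
            GvMinus (G.induce (compSet G v u)) (compVert G v u)) ∨
    (∃ B : Finset V, (∀ b ∈ B, G.Adj v b) ∧ B.card = s ∧
        (∀ b ∈ B, ¬ HasZeroOneProperty (G.induce (compSet G v b))) ∧
        ∀ u : V, G.Adj v u → u ∉ B →
          GvMinus (G.induce (compSet G v u)) (compVert G v u)) := by
  obtain ⟨hA, hP⟩ := gvAB_iff_rootColours_subset.1 h
  let χ : G.Coloring (ZMod 2) := hG.coloringTwo
  let A : V → Set ℕ := fun u => rootColours (G.induce (compSet G v u)) (compVert G v u) 0
  let P : V → Set ℕ := fun u => rootColours (G.induce (compSet G v u)) (compVert G v u) 1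
  have hN : ∀ u, u ∈ Finset.univ.filter (fun u => G.Adj v u) ↔ G.Adj v u := by simp
  have hpar : ∀ u ∈ Finset.univ.filter (fun u => G.Adj v u), ∀ j : ℕ,
      ∃ k, k % 2 = j % 2 ∧ (k ∈ A u ∨ k ∈ P u) := fun u hu j =>
    exists_mem_rootColours_mod_two (induce_compSet_connected ((hN u).1 hu))
      (χ.comp (SimpleGraph.Embedding.induce _).toHom) _ j
  have hglue : ∀ S ⊆ Finset.univ.filter (fun u => G.Adj v u), ∀ ε ≤ 1,
      (∀ u ∈ Finset.univ.filter (fun u => G.Adj v u),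
        ∃ k ∈ (if u ∈ S then P u else A u), k ≠ S.card + ε) → S.card = s := by
    intro S hS ε hε hk
    have hmem : S.card + ε ∈ rootColours G v ε := by
      refine card_add_mem_rootColours hG v S (fun u hu => (hN u).1 (hS hu)) ε fun u hu => ?_
      have := hk u ((hN u).2 hu)
      split_ifs at this ⊢ <;> exact this
    interval_cases ε
    · exact hA hmem
    · exact Nat.succ_injective (hP hmem)
  rcases classify_branches _ A P s hpar hglue with
    ⟨hs, v₁, hv₁, v₂, hv₂, hne, hA₁, hP₁, hA₂, hP₂, B, hBN, h₁, h₂, hB, hbad, hminus⟩ |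
    ⟨B, hBN, hB, hbad, hminus⟩
  · exact .inl ⟨hs, v₁, v₂, (hN _).1 hv₁, (hN _).1 hv₂, hne,
      gvAB_iff_rootColours_subset.2 ⟨hA₁, hP₁⟩, gvAB_iff_rootColours_subset.2 ⟨hA₂, hP₂⟩, B,
      fun b hb => (hN b).1 (hBN hb), h₁, h₂, hB,
      fun b hb => not_hasZeroOneProperty_of_rootColours_eq_empty (hbad b hb),
      fun u hu hu₁ hu₂ huB =>
        gvMinus_of_rootColours_eq_empty (hminus u ((hN u).2 hu) hu₁ hu₂ huB)⟩
  · exact .inr ⟨B, fun b hb => (hN b).1 (hBN hb), hB,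
      fun b hb => not_hasZeroOneProperty_of_rootColours_eq_empty (hbad b hb),
      fun u hu huB => gvMinus_of_rootColours_eq_empty (hminus u ((hN u).2 hu) huB)⟩
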